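/- arXiv:2006.08499 — 2 statements merged into one kernel-verified Lean document; each statement's English description precedes it below -/
import Mathlib

section
/- Every non-group H-class of a strongly subsemigroup separable semigroup is finite. That is, if S is a strongly subsemigroup separable semigroup and H is an H-class of S which is not a group (H ∩ H² = ∅), then H is finite. -/
open scoped Pointwise

/-- A semigroup is residually finite if distinct points can be distinguished in a
finite semigroup quotient (image). -/
def IsResiduallyFiniteSemigroup (S : Type*) [Semigroup S] : Prop :=
  ∀ s t : S, s ≠ t →
    ∃ (U : Type) (_ : Semigroup U) (_ : Finite U) (f : S →ₙ* U), f s ≠ f t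

/-- A semigroup is weakly subsemigroup separable if every element outside a finitely
generated subsemigroup can be separated from it in a finite semigroup image. -/
def IsWeaklySubsemigroupSeparable (S : Type*) [Semigroup S] : Prop :=
  ∀ T : Subsemigroup S, (∃ Y : Finset S, T = Subsemigroup.closure (Y : Set S)) →
    ∀ s : S, s ∉ T →
      ∃ (U : Type) (_ : Semigroup U) (_ : Finite U) (f : S →ₙ* U),
        f s ∉ f '' (T : Set S)

/-- A semigroup is strongly subsemigroup separable if every element outside a
subsemigroup can be separated from it in a finite semigroup image. -/
def IsStronglySubsemigroupSeparable (S : Type*) [Semigroup S] : Prop :=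
  ∀ T : Subsemigroup S, ∀ s : S, s ∉ T →
    ∃ (U : Type) (_ : Semigroup U) (_ : Finite U) (f : S →ₙ* U),
      f s ∉ f '' (T : Set S)

/-- A semigroup is completely separable if every element can be separated from its
complement in a finite semigroup image. -/
def IsCompletelySeparable (S : Type*) [Semigroup S] : Prop :=
  ∀ s : S,
    ∃ (U : Type) (_ : Semigroup U) (_ : Finite U) (f : S →ₙ* U),
      f s ∉ f '' {t : S | t ≠ s}

/-- A semigroup is locally finite if every finitely generated subsemigroup is finite. -/
def IsLocallyFiniteSemigroup (S : Type*) [Semigroup S] : Prop :=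
  ∀ Y : Finset S, ((Subsemigroup.closure (Y : Set S) : Subsemigroup S) : Set S).Finite

/-- A group is weakly subgroup separable (LERF) if every element outside a finitely
generated subgroup can be separated from it in a finite group image. -/
def IsWeaklySubgroupSeparable (G : Type*) [Group G] : Prop :=
  ∀ H : Subgroup G, H.FG → ∀ g : G, g ∉ H →
    ∃ (K : Type) (_ : Group K) (_ : Finite K) (f : G →* K),
      f g ∉ f '' (H : Set G)

/-- A group is strongly subgroup separable (ERF) if every element outside a subgroup
can be separated from it in a finite group image. -/
def IsStronglySubgroupSeparable (G : Type*) [Group G] : Prop :=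
  ∀ H : Subgroup G, ∀ g : G, g ∉ H →
    ∃ (K : Type) (_ : Group K) (_ : Finite K) (f : G →* K),
      f g ∉ f '' (H : Set G)

/-- Green's relation H: x H y iff xS¹ = yS¹ and S¹x = S¹y. -/
def GreenH {S : Type*} [Semigroup S] (x y : S) : Prop :=
  insert x {z : S | ∃ s : S, z = x * s} = insert y {z : S | ∃ s : S, z = y * s} ∧
  insert x {z : S | ∃ s : S, z = s * x} = insert y {z : S | ∃ s : S, z = s * y}

/-- The H-class of an element. -/
def HClass {S : Type*} [Semigroup S] (x : S) : Set S := {y : S | GreenH x y}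

/-- The n-fold pointwise product A·A⋯A (for n ≥ 1; we set the value at 0 to be A). -/
def SetNPow {S : Type*} [Semigroup S] (A : Set S) : ℕ → Set S
  | 0 => A
  | 1 => A
  | n + 2 => SetNPow A (n + 1) * A

/-- The right stabiliser Stab(H) = {s ∈ S¹ | Hs = H}, a submonoid of S¹ = WithOne S. -/
def SchStab {S : Type*} [Semigroup S] (H : Set S) : Submonoid (WithOne S) where
  carrier := {s : WithOne S |
    (fun h => h * s) '' ((fun x : S => (x : WithOne S)) '' H)
      = (fun x : S => (x : WithOne S)) '' H}
  one_mem' := by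
    simp only [Set.mem_setOf_eq, mul_one, Set.image_id']
  mul_mem' := by
    intro a b ha hb
    simp only [Set.mem_setOf_eq] at ha hb ⊢
    have hcomp : (fun h : WithOne S => h * (a * b))
        = (fun h : WithOne S => h * b) ∘ fun h : WithOne S => h * a := by
      funext h; simp [mul_assoc]
    rw [hcomp, Set.image_comp, ha, hb]

/-- `(Γ, φ)` realises the Schützenberger group of the H-class `H`: `φ` is a surjective
monoid homomorphism from `Stab(H)` onto the group `Γ` whose kernel relation is exactly
the Schützenberger congruence `σ_H`. -/
def IsSchutzenbergerGroup {S : Type*} [Semigroup S] (H : Set S) (Γ : Type*) [Group Γ]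
    (φ : SchStab H →* Γ) : Prop :=
  Function.Surjective φ ∧
    ∀ a b : SchStab H,
      φ a = φ b ↔ ∀ h ∈ H,
        (h : WithOne S) * (a : WithOne S) = (h : WithOne S) * (b : WithOne S)

theorem insert_mul_right_eq_iff {S : Type*} [Semigroup S] {x y : S} :
    insert x {z : S | ∃ s : S, z = x * s} = insert y {z : S | ∃ s : S, z = y * s} ↔
      (∃ s : WithOne S, (x : WithOne S) = y * s) ∧ ∃ s : WithOne S, (y : WithOne S) = x * s := by
  have key (a b : S) : a ∈ insert b {z : S | ∃ s : S, z = b * s} ↔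
      ∃ s : WithOne S, (a : WithOne S) = b * s := by
    simp [WithOne.exists, ← WithOne.coe_mul, WithOne.coe_inj]
  rw [← key, ← key]
  refine ⟨fun h => ⟨h ▸ Set.mem_insert _ _, h.symm ▸ Set.mem_insert _ _⟩, fun ⟨h, h'⟩ => ?_⟩
  ext z
  rw [key] at h h' ⊢
  rw [key]
  obtain ⟨s, hs⟩ := h
  obtain ⟨t, ht⟩ := h'
  constructor
  · rintro ⟨u, hu⟩
    exact ⟨s * u, by rw [hu, hs, mul_assoc]⟩
  · rintro ⟨u, hu⟩
    exact ⟨t * u, by rw [hu, ht, mul_assoc]⟩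

theorem insert_mul_left_eq_iff {S : Type*} [Semigroup S] {x y : S} :
    insert x {z : S | ∃ s : S, z = s * x} = insert y {z : S | ∃ s : S, z = s * y} ↔
      (∃ s : WithOne S, (x : WithOne S) = s * y) ∧ ∃ s : WithOne S, (y : WithOne S) = s * x := by
  have key (a b : S) : a ∈ insert b {z : S | ∃ s : S, z = s * b} ↔
      ∃ s : WithOne S, (a : WithOne S) = s * b := by
    simp [WithOne.exists, ← WithOne.coe_mul, WithOne.coe_inj]
  rw [← key, ← key]
  refine ⟨fun h => ⟨h ▸ Set.mem_insert _ _, h.symm ▸ Set.mem_insert _ _⟩, fun ⟨h, h'⟩ => ?_⟩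
  ext z
  rw [key] at h h' ⊢
  rw [key]
  obtain ⟨s, hs⟩ := h
  obtain ⟨t, ht⟩ := h'
  constructor
  · rintro ⟨u, hu⟩
    exact ⟨u * s, by rw [hu, hs, mul_assoc]⟩
  · rintro ⟨u, hu⟩
    exact ⟨u * t, by rw [hu, ht, mul_assoc]⟩

/-- Green's relation `H` expressed through multiplication in `S¹`. -/
theorem greenH_iff {S : Type*} [Semigroup S] {x y : S} :
    GreenH x y ↔
      ((∃ s : WithOne S, (x : WithOne S) = y * s) ∧ ∃ s : WithOne S, (y : WithOne S) = x * s) ∧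
      ((∃ s : WithOne S, (x : WithOne S) = s * y) ∧ ∃ s : WithOne S, (y : WithOne S) = s * x) :=
  and_congr insert_mul_right_eq_iff insert_mul_left_eq_iff

theorem GreenH.symm {S : Type*} [Semigroup S] {x y : S} (h : GreenH x y) : GreenH y x :=
  ⟨h.1.symm, h.2.symm⟩

theorem GreenH.trans {S : Type*} [Semigroup S] {x y z : S} (h : GreenH x y) (h' : GreenH y z) :
    GreenH x z :=
  ⟨h.1.trans h'.1, h.2.trans h'.2⟩

/-- Every element of the subsemigroup generated by a subset `X` of an `H`-class `H` either lies
in `X` or both begins and ends with an element of `H * H`. -/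
theorem mem_or_begins_ends_in_mul_of_mem_closure {S : Type*} [Semigroup S] {H X : Set S}
    (hX : X ⊆ H) {t : S} (ht : t ∈ Subsemigroup.closure X) :
    t ∈ X ∨
      (∃ a ∈ H, ∃ c ∈ H, ∃ u : WithOne S, (t : WithOne S) = a * c * u) ∧
      ∃ d ∈ H, ∃ b ∈ H, ∃ v : WithOne S, (t : WithOne S) = v * (d * b) := by
  induction ht using Subsemigroup.closure_induction with
  | mem t ht => exact Or.inl ht
  | mul s t _ _ hs ht =>
    right
    constructor
    · rcases hs with hs | ⟨⟨a, ha, c, hc, u, hu⟩, -⟩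
      · rcases ht with ht | ⟨⟨a, ha, c, hc, u, hu⟩, -⟩
        · exact ⟨s, hX hs, t, hX ht, 1, by simp⟩
        · exact ⟨s, hX hs, a, ha, c * u, by simp [hu, mul_assoc]⟩
      · exact ⟨a, ha, c, hc, u * t, by simp [hu, mul_assoc]⟩
    · rcases ht with ht | ⟨-, ⟨d, hd, b, hb, v, hv⟩⟩
      · rcases hs with hs | ⟨-, ⟨d, hd, b, hb, v, hv⟩⟩
        · exact ⟨s, hX hs, t, hX ht, 1, by simp⟩
        · exact ⟨b, hb, t, hX ht, v * d, by simp [hv, mul_assoc]⟩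
      · exact ⟨d, hd, b, hb, s * v, by simp [hv, mul_assoc]⟩

/-- If an element of an `H`-class both begins and ends with a product of two
elements of the class, then the class contains a product of two of its elements. -/
theorem exists_mul_mem_HClass {S : Type*} [Semigroup S] {x a b c d : S}
    (ha : GreenH x a) (hb : GreenH x b) (hc : GreenH x c) (hd : GreenH x d) {u v : WithOne S}
    (hu : (x : WithOne S) = a * c * u) (hv : (x : WithOne S) = v * (d * b)) :
    GreenH x (d * c) := by
  obtain ⟨⟨-, p, hp⟩, -⟩ := greenH_iff.1 ha
  obtain ⟨-, -, q, hq⟩ := greenH_iff.1 (ha.symm.trans hd)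
  obtain ⟨-, -, r, hr⟩ := greenH_iff.1 hb
  obtain ⟨⟨-, w, hw⟩, -⟩ := greenH_iff.1 (hb.symm.trans hc)
  obtain ⟨⟨⟨g, hg⟩, e, he⟩, -⟩ := greenH_iff.1 hd
  obtain ⟨-, ⟨k, hk⟩, l, hl⟩ := greenH_iff.1 hc
  have hd' : (d : WithOne S) = d * c * (u * p) := by
    calc (d : WithOne S) = q * a := hq
      _ = q * (a * c * u * p) := by rw [← hu, ← hp]
      _ = q * a * c * (u * p) := by simp only [mul_assoc]
      _ = d * c * (u * p) := by rw [← hq]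
  have hc' : (c : WithOne S) = r * v * (d * c) := by
    calc (c : WithOne S) = b * w := hw
      _ = r * (v * (d * b)) * w := by rw [← hv, ← hr]
      _ = r * v * (d * (b * w)) := by simp only [mul_assoc]
      _ = r * v * (d * c) := by rw [← hw]
  refine greenH_iff.2 ⟨⟨⟨u * p * g, ?_⟩, e * c, ?_⟩, ⟨k * (r * v), ?_⟩, d * l, ?_⟩
  · rw [WithOne.coe_mul, ← mul_assoc, ← hd', ← hg]
  · rw [WithOne.coe_mul, ← mul_assoc, ← he]
  · rw [WithOne.coe_mul, mul_assoc, ← hc', ← hk]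
  · rw [WithOne.coe_mul, mul_assoc, ← hl]

/-- A subset of a non-group `H`-class generates no further elements of that class. -/
theorem notMem_closure_of_nongroup {S : Type*} [Semigroup S] {x : S}
    (hng : HClass x ∩ (HClass x * HClass x) = ∅) {X : Set S} (hX : X ⊆ HClass x) (hx : x ∉ X) :
    x ∉ Subsemigroup.closure X := by
  intro h
  obtain h | ⟨⟨a, ha, c, hc, u, hu⟩, d, hd, b, hb, v, hv⟩ :=
    mem_or_begins_ends_in_mul_of_mem_closure hX h
  · exact hx h
  · exact Set.eq_empty_iff_forall_notMem.1 hng (d * c)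
      ⟨exists_mul_mem_HClass ha hb hc hd hu hv, Set.mul_mem_mul hd hc⟩

/-- A homomorphism that separates `x` from the rest of its `H`-class is injective on that class. -/
theorem injOn_HClass_of_separates {S U : Type*} [Semigroup S] [Semigroup U] (f : S →ₙ* U) {x : S}
    (hf : ∀ y ∈ HClass x, f x = f y → x = y) : Set.InjOn f (HClass x) := by
  intro a ha b hb hab
  obtain ⟨⟨⟨u, hu⟩, z, hz⟩, -⟩ := greenH_iff.1 ha
  obtain ⟨-, ⟨v, hv⟩, w, hw⟩ := greenH_iff.1 (ha.symm.trans hb)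
  obtain ⟨⟨⟨g, hg⟩, e, he⟩, -⟩ := greenH_iff.1 hb
  have hb' : (b : WithOne S) = b * u * z := by
    calc (b : WithOne S) = w * a := hw
      _ = w * (a * u * z) := by rw [← hu, ← hz]
      _ = w * a * u * z := by simp only [mul_assoc]
      _ = b * u * z := by rw [← hw]
  obtain ⟨y, hy, hfy⟩ : ∃ y : S, (y : WithOne S) = b * u ∧ f x = f y := by
    obtain rfl | ⟨u, rfl⟩ : u = 1 ∨ ∃ u' : S, u = u' :=
      (eq_or_ne u 1).imp_right fun h => (WithOne.ne_one_iff_exists.1 h).imp fun _ => Eq.symm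
    · exact ⟨b, by simp, by rw [← hab, WithOne.coe_inj.1 (hu.trans (mul_one _))]⟩
    · rw [← WithOne.coe_mul, WithOne.coe_inj] at hu
      exact ⟨b * u, WithOne.coe_mul _ _, by rw [hu, map_mul, map_mul, hab]⟩
  have hxy : x = y := by
    refine hf y (greenH_iff.2 ⟨⟨⟨z * g, ?_⟩, e * u, ?_⟩, ⟨v, ?_⟩, w, ?_⟩) hfy
    · rw [hy, ← mul_assoc, ← hb', ← hg]
    · rw [hy, ← mul_assoc, ← he]
    · rw [hy, ← mul_assoc, ← hv, ← hu]
    · rw [hy, hw, mul_assoc, ← hu]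
  rw [← WithOne.coe_inj, hb', ← hy, ← hxy, ← hz]

theorem nongroup_hclass_finite (S : Type*) [Semigroup S]
    (hS : IsStronglySubsemigroupSeparable S) (x : S)
    (hng : HClass x ∩ (HClass x * HClass x) = ∅) :
    (HClass x).Finite := by
  obtain ⟨U, _, _, f, hf⟩ := hS _ x
    (notMem_closure_of_nongroup hng (X := HClass x \ {x}) Set.sdiff_subset (by simp))
  refine Set.Finite.of_finite_image (Set.toFinite (f '' HClass x))
    (injOn_HClass_of_separates f fun y hy hxy => ?_)
  by_contra hne
  exact hf ⟨y, Subsemigroup.subset_closure ⟨hy, Ne.symm hne⟩, hxy.symm⟩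
end

section
/- Every Schützenberger group of a weakly subsemigroup separable commutative semigroup is itself weakly subsemigroup separable: if S is a commutative semigroup that is weakly subsemigroup separable and H is an H-class of S, then Γ(H), viewed as a semigroup, is weakly subsemigroup separable. -/
open scoped Pointwise

/-- Weak subsemigroup separability pulls back along injective homomorphisms. -/
theorem IsWeaklySubsemigroupSeparable.of_injective {G S : Type*} [Semigroup G] [Semigroup S]
    (hS : IsWeaklySubsemigroupSeparable S) (ψ : G →ₙ* S) (hψ : Function.Injective ψ) :
    IsWeaklySubsemigroupSeparable G := by
  classical
  rintro T ⟨Y, rfl⟩ g hg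
  obtain ⟨U, hU, hfin, f, hf⟩ := hS ((Subsemigroup.closure (Y : Set G)).map ψ)
    ⟨Y.image ψ, by rw [MulHom.map_mclosure, Finset.coe_image]⟩ (ψ g)
    (by rwa [Subsemigroup.mem_map_iff_mem hψ])
  refine ⟨U, hU, hfin, f.comp ψ, ?_⟩
  rintro ⟨t, ht, hfg⟩
  exact hf ⟨ψ t, ⟨t, ht, rfl⟩, hfg⟩

/-- The quotient by a congruence of finite index can be taken in `Type`. -/
theorem Con.exists_finite_image {G : Type*} [Semigroup G] (c : Con G) [Finite c.Quotient] :
    ∃ (U : Type) (_ : Semigroup U) (_ : Finite U) (f : G →ₙ* U),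
      ∀ a b : G, f a = f b ↔ c a b := by
  refine ⟨Shrink.{0} c.Quotient, inferInstance, inferInstance,
    { toFun := fun a => Shrink.mulEquiv.symm (a : c.Quotient),
      map_mul' := fun a b => by rw [Con.coe_mul, map_mul] }, fun a b => ?_⟩
  exact Shrink.mulEquiv.symm.injective.eq_iff.trans (Con.eq c)

theorem WithOne.eq_one_or_exists_eq_coe {S : Type*} (u : WithOne S) : u = 1 ∨ ∃ s : S, u = s := by
  induction u using WithOne.recOneCoe with
  | one => exact Or.inl rfl
  | coe s => exact Or.inr ⟨s, rfl⟩

section GreenH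

variable {S : Type*} [CommSemigroup S]

theorem WithOne.exists_coe_eq_coe_mul (x : S) (u : WithOne S) :
    ∃ y : S, (y : WithOne S) = (x : WithOne S) * u := by
  induction u using WithOne.recOneCoe with
  | one => exact ⟨x, (mul_one _).symm⟩
  | coe u => exact ⟨x * u, rfl⟩

theorem WithOne.coe_dvd_coe_iff (x y : S) :
    (x : WithOne S) ∣ (y : WithOne S) ↔ y = x ∨ ∃ s : S, y = x * s := by
  constructor
  · rintro ⟨u, hu⟩
    induction u using WithOne.recOneCoe with
    | one => exact Or.inl (WithOne.coe_injective (by simpa using hu))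
    | coe u => exact Or.inr ⟨u, WithOne.coe_injective (by simpa using hu)⟩
  · rintro (rfl | ⟨s, rfl⟩)
    · exact dvd_rfl
    · exact ⟨s, rfl⟩

theorem mem_HClass_iff_dvd (x y : S) :
    y ∈ HClass x ↔
      (x : WithOne S) ∣ (y : WithOne S) ∧ (y : WithOne S) ∣ (x : WithOne S) := by
  have key : ∀ z : S, insert z {w : S | ∃ s : S, w = z * s}
      = {w : S | (z : WithOne S) ∣ (w : WithOne S)} := by
    intro z
    ext w
    simp [WithOne.coe_dvd_coe_iff]
  have key' : ∀ z : S, insert z {w : S | ∃ s : S, w = s * z}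
      = {w : S | (z : WithOne S) ∣ (w : WithOne S)} := by
    intro z
    rw [← key]
    simp only [mul_comm]
  change GreenH x y ↔ _
  unfold GreenH
  rw [key, key, key', key', and_self]
  constructor
  · intro h
    have h1 : x ∈ {w : S | (y : WithOne S) ∣ (w : WithOne S)} := h ▸ dvd_refl _
    have h2 : y ∈ {w : S | (x : WithOne S) ∣ (w : WithOne S)} := h.symm ▸ dvd_refl _
    exact ⟨h2, h1⟩
  · rintro ⟨h1, h2⟩
    ext w
    exact ⟨fun h => h2.trans h, fun h => h1.trans h⟩

theorem mem_SchStab_HClass_iff (x : S) (s : WithOne S) :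
    s ∈ SchStab (HClass x) ↔ (x : WithOne S) * s ∣ (x : WithOne S) := by
  change (fun h => h * s) '' ((fun y : S => (y : WithOne S)) '' HClass x)
      = (fun y : S => (y : WithOne S)) '' HClass x ↔ _
  constructor
  · intro h
    have hx : (x : WithOne S) * s ∈ (fun y : S => (y : WithOne S)) '' HClass x :=
      h ▸ ⟨x, ⟨x, (mem_HClass_iff_dvd x x).2 ⟨dvd_rfl, dvd_rfl⟩, rfl⟩, rfl⟩
    obtain ⟨y, hy, hyx⟩ := hx
    exact hyx ▸ ((mem_HClass_iff_dvd x y).1 hy).2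
  · rintro ⟨v, hv⟩
    ext w
    constructor
    · rintro ⟨_, ⟨h, hh, rfl⟩, rfl⟩
      obtain ⟨y, hy⟩ := WithOne.exists_coe_eq_coe_mul h s
      rw [mem_HClass_iff_dvd] at hh
      obtain ⟨⟨u, hu⟩, ⟨u', hu'⟩⟩ := hh
      refine ⟨y, (mem_HClass_iff_dvd x y).2 ⟨?_, ?_⟩, hy⟩
      · exact hy ▸ ⟨u * s, by rw [hu, mul_assoc]⟩
      · refine hy ▸ ⟨u' * v, ?_⟩
        calc (x : WithOne S) = x * s * v := hv
          _ = h * u' * s * v := by rw [← hu']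
          _ = h * s * (u' * v) := by ac_rfl
    · rintro ⟨h, hh, rfl⟩
      obtain ⟨y, hy⟩ := WithOne.exists_coe_eq_coe_mul h v
      rw [mem_HClass_iff_dvd] at hh
      obtain ⟨⟨u, hu⟩, ⟨u', hu'⟩⟩ := hh
      have hys : (y : WithOne S) * s = h := by
        calc (y : WithOne S) * s = h * v * s := by rw [hy]
          _ = x * u * v * s := by rw [hu]
          _ = x * s * v * u := by ac_rfl
          _ = h := by rw [← hv, hu]
      refine ⟨y, ⟨y, (mem_HClass_iff_dvd x y).2 ⟨?_, ?_⟩, rfl⟩, hys⟩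
      · exact hy ▸ ⟨u * v, by rw [hu, mul_assoc]⟩
      · exact ⟨s * u', by rw [← mul_assoc, hys, ← hu']⟩

theorem IsSchutzenbergerGroup.map_eq_map_iff {x : S} {Γ : Type*} [Group Γ]
    {φ : SchStab (HClass x) →* Γ} (hφ : IsSchutzenbergerGroup (HClass x) Γ φ)
    (a b : SchStab (HClass x)) :
    φ a = φ b ↔ (x : WithOne S) * (a : WithOne S) = (x : WithOne S) * (b : WithOne S) := by
  rw [hφ.2]
  constructor
  · exact fun h => h x ((mem_HClass_iff_dvd x x).2 ⟨dvd_rfl, dvd_rfl⟩)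
  · intro h y hy
    obtain ⟨u, hu⟩ := ((mem_HClass_iff_dvd x y).1 hy).1
    rw [hu, mul_right_comm, h, mul_right_comm]

end GreenH

theorem schutzenberger_weakly_separable_comm (S : Type*) [CommSemigroup S]
    (hS : IsWeaklySubsemigroupSeparable S) (x : S)
    (Γ : Type*) [Group Γ] (φ : SchStab (HClass x) →* Γ)
    (hφ : IsSchutzenbergerGroup (HClass x) Γ φ) :
    IsWeaklySubsemigroupSeparable Γ := by
  have hcomm : ∀ γ δ : Γ, γ * δ = δ * γ := by
    intro γ δ
    obtain ⟨a, rfl⟩ := hφ.1 γ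
    obtain ⟨b, rfl⟩ := hφ.1 δ
    rw [← map_mul, ← map_mul]
    exact congrArg φ (Subtype.ext (mul_comm _ _))
  choose σ hσ using hφ.1
  by_cases hreg : ∃ h : S, h ∈ HClass x ∧ (h : WithOne S) ∈ SchStab (HClass x)
  · -- `H` is a group, and it contains a copy of `Γ`.
    obtain ⟨h, hh, hhs⟩ := hreg
    obtain ⟨e, he⟩ := WithOne.exists_coe_eq_coe_mul h
      (σ (φ ⟨h, hhs⟩)⁻¹ : WithOne S)
    have hes : (e : WithOne S) ∈ SchStab (HClass x) := by
      rw [he]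
      exact mul_mem hhs (σ _).2
    have hφe : φ ⟨e, hes⟩ = 1 := by
      have : (⟨e, hes⟩ : SchStab (HClass x)) = ⟨h, hhs⟩ * σ (φ ⟨h, hhs⟩)⁻¹ := Subtype.ext he
      rw [this, map_mul, hσ, mul_inv_cancel]
    have hxe : (x : WithOne S) ∣ e := by
      rw [he]
      exact ((mem_HClass_iff_dvd x h).1 hh).1.mul_right _
    choose ψ hψ using fun γ : Γ => WithOne.exists_coe_eq_coe_mul e (σ γ : WithOne S)
    have hψs : ∀ γ, (ψ γ : WithOne S) ∈ SchStab (HClass x) := fun γ => by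
      rw [hψ]
      exact mul_mem hes (σ γ).2
    have hφψ : ∀ γ, φ ⟨ψ γ, hψs γ⟩ = γ := by
      intro γ
      have : (⟨ψ γ, hψs γ⟩ : SchStab (HClass x)) = ⟨e, hes⟩ * σ γ := Subtype.ext (hψ γ)
      rw [this, map_mul, hφe, hσ, one_mul]
    have hψeq : ∀ (γ : Γ) (a : SchStab (HClass x)), φ a = γ → (e : WithOne S) * a = ψ γ := by
      intro γ a ha
      obtain ⟨u, hu⟩ := hxe
      have := (hφ.map_eq_map_iff a (σ γ)).1 (by rw [ha, hσ])
      rw [hψ, hu, mul_right_comm, this, mul_right_comm]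
    have hee : ∀ γ, (e : WithOne S) * ψ γ = ψ γ := fun γ => hψeq γ ⟨ψ γ, hψs γ⟩ (hφψ γ)
    refine hS.of_injective
      { toFun := ψ, map_mul' := fun γ δ => WithOne.coe_injective ?_ } ?_
    · rw [← hψeq (γ * δ) (⟨ψ γ, hψs γ⟩ * ⟨ψ δ, hψs δ⟩) (by rw [map_mul, hφψ, hφψ])]
      change (e : WithOne S) * (ψ γ * ψ δ) = ψ γ * ψ δ
      rw [← mul_assoc, hee]
    · intro γ δ h
      have h' : ψ γ = ψ δ := h
      rw [← hφψ γ, ← hφψ δ]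
      exact congrArg φ (Subtype.ext (congrArg (fun s : S => (s : WithOne S)) h'))
  · choose ρ hρ using fun γ : Γ => WithOne.exists_coe_eq_coe_mul x (σ γ : WithOne S)
    have hρeq : ∀ (γ : Γ) (a : SchStab (HClass x)), φ a = γ → (x : WithOne S) * a = ρ γ := by
      intro γ a ha
      rw [hρ]
      exact (hφ.map_eq_map_iff a (σ γ)).1 (by rw [ha, hσ])
    have hρdvd : ∀ γ, (ρ γ : WithOne S) ∣ x := fun γ => by
      rw [hρ]
      exact (mem_SchStab_HClass_iff x _).1 (σ γ).2
    have hρH : ∀ γ, ρ γ ∈ HClass x := fun γ =>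
      (mem_HClass_iff_dvd x _).2 ⟨⟨σ γ, hρ γ⟩, hρdvd γ⟩
    have hρinj : Function.Injective ρ := by
      intro γ δ h
      rw [← hσ γ, ← hσ δ, hφ.map_eq_map_iff, ← hρ, ← hρ, h]
    have hρmul : ∀ γ δ, (ρ γ : WithOne S) * σ δ = ρ (γ * δ) := by
      intro γ δ
      rw [hρ γ, mul_assoc]
      exact hρeq _ (σ γ * σ δ) (by rw [map_mul, hσ, hσ])
    have hxx : ∀ γ, ¬ (x : WithOne S) * x ∣ ρ γ := fun γ h =>
      hreg ⟨x, (mem_HClass_iff_dvd x x).2 ⟨dvd_rfl, dvd_rfl⟩,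
        (mem_SchStab_HClass_iff x x).2 (h.trans (hρdvd γ))⟩
    rintro T ⟨Y, rfl⟩ g hg
    set T := Subsemigroup.closure (Y : Set Γ) with hT
    let Z : Set S := ρ '' Y ∪
      (fun s : S => (s : WithOne S)) ⁻¹' ((fun γ => (σ γ : WithOne S)) '' Y)
    have hZ : Z.Finite := (Y.finite_toSet.image ρ).union
      ((Y.finite_toSet.image _).preimage WithOne.coe_injective.injOn)
    have hZle : ∀ z ∈ Subsemigroup.closure Z,
        (∃ h : (z : WithOne S) ∈ SchStab (HClass x), φ ⟨z, h⟩ ∈ T) ∨ (∃ t ∈ T, z = ρ t) ∨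
          (x : WithOne S) * x ∣ (z : WithOne S) := by
      have hmix : ∀ (z : S) (h : (z : WithOne S) ∈ SchStab (HClass x)) (t : Γ),
          ρ t * z = ρ (t * φ ⟨z, h⟩) := by
        intro z h t
        apply WithOne.coe_injective
        rw [← hρeq (t * φ ⟨z, h⟩) (σ t * ⟨z, h⟩) (by rw [map_mul, hσ]), WithOne.coe_mul, hρ]
        exact mul_assoc _ _ _
      intro z hz
      induction hz using Subsemigroup.closure_induction with
      | mem z hz =>
        rcases hz with ⟨a, ha, rfl⟩ | ⟨a, ha, haz⟩
        · exact Or.inr (Or.inl ⟨a, Subsemigroup.subset_closure ha, rfl⟩)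
        · have haz' : (σ a : WithOne S) = z := haz
          refine Or.inl ⟨haz' ▸ (σ a).2, ?_⟩
          have : (⟨z, haz' ▸ (σ a).2⟩ : SchStab (HClass x)) = σ a := Subtype.ext haz'.symm
          rw [this, hσ]
          exact Subsemigroup.subset_closure ha
      | mul z w _ _ hz hw =>
        rcases hz with ⟨hz, hzT⟩ | ⟨t, ht, rfl⟩ | hz
        · rcases hw with ⟨hw, hwT⟩ | ⟨t, ht, rfl⟩ | hw
          · refine Or.inl ⟨mul_mem hz hw, ?_⟩
            have := T.mul_mem hzT hwT
            rwa [← map_mul] at this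
          · exact Or.inr (Or.inl ⟨_, T.mul_mem ht hzT, by rw [mul_comm, hmix]⟩)
          · exact Or.inr (Or.inr (hw.mul_left (z : WithOne S)))
        · rcases hw with ⟨hw, hwT⟩ | ⟨t', ht', rfl⟩ | hw
          · exact Or.inr (Or.inl ⟨_, T.mul_mem ht hwT, hmix _ hw _⟩)
          · refine Or.inr (Or.inr ?_)
            rw [WithOne.coe_mul, hρ, hρ]
            exact mul_dvd_mul (dvd_mul_right _ _) (dvd_mul_right _ _)
          · exact Or.inr (Or.inr (hw.mul_left (ρ t : WithOne S)))
        · exact Or.inr (Or.inr (hz.mul_right (w : WithOne S)))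
    have hρT : ∀ t ∈ T, ρ t ∈ Subsemigroup.closure Z ∧
        ∀ γ, ρ γ ∈ Subsemigroup.closure Z → ρ (γ * t) ∈ Subsemigroup.closure Z := by
      intro t ht
      induction ht using Subsemigroup.closure_induction with
      | mem a ha =>
        refine ⟨Subsemigroup.subset_closure (Or.inl ⟨a, ha, rfl⟩), fun γ hγ => ?_⟩
        have hmul := hρmul γ a
        obtain h | ⟨s, h⟩ := WithOne.eq_one_or_exists_eq_coe (σ a : WithOne S)
        · rw [h, mul_one] at hmul
          rwa [← WithOne.coe_injective hmul]
        · rw [h, ← WithOne.coe_mul] at hmul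
          rw [← WithOne.coe_injective hmul]
          exact mul_mem hγ (Subsemigroup.subset_closure (Or.inr ⟨a, ha, h⟩))
      | mul a b _ _ ha hb =>
        refine ⟨hb.2 a ha.1, fun γ hγ => ?_⟩
        rw [← mul_assoc]
        exact hb.2 _ (ha.2 _ hγ)
    have hgZ : ρ g ∉ Subsemigroup.closure Z := by
      intro h
      rcases hZle _ h with ⟨h, -⟩ | ⟨t, ht, h⟩ | h
      · exact hreg ⟨ρ g, hρH g, h⟩
      · exact hg (hρinj h ▸ ht)
      · exact hxx g h
    obtain ⟨U, hU, hfin, f, hf⟩ := hS (Subsemigroup.closure Z) ⟨hZ.toFinset, by simp⟩ (ρ g) hgZ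
    have hstep : ∀ γ δ ε : Γ, f (ρ γ) = f (ρ δ) → f (ρ (γ * ε)) = f (ρ (δ * ε)) := by
      intro γ δ ε h
      have h1 := hρmul γ ε
      have h2 := hρmul δ ε
      obtain hs | ⟨s, hs⟩ := WithOne.eq_one_or_exists_eq_coe (σ ε : WithOne S)
      · rw [hs, mul_one] at h1 h2
        rwa [← WithOne.coe_injective h1, ← WithOne.coe_injective h2]
      · rw [hs, ← WithOne.coe_mul] at h1 h2
        rw [← WithOne.coe_injective h1, ← WithOne.coe_injective h2, map_mul, map_mul, h]
    let c : Con Γ :=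
      { Setoid.ker (fun γ => f (ρ γ)) with
        mul' := by
          intro γ δ γ' δ' h h'
          change f (ρ (γ * γ')) = f (ρ (δ * δ'))
          rw [hstep γ δ γ' h, hcomm δ γ', hcomm δ δ', hstep γ' δ' δ h'] }
    have : Finite c.Quotient :=
      Finite.of_injective (Setoid.kerLift (fun γ => f (ρ γ))) (Setoid.kerLift_injective _)
    obtain ⟨V, hV, hVfin, q, hq⟩ := c.exists_finite_image
    refine ⟨V, hV, hVfin, q, ?_⟩
    rintro ⟨t, ht, htg⟩
    exact hf ⟨ρ t, (hρT t ht).1, (hq t g).1 htg⟩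
end
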